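/- Consider any non-trivial irreducible unitary representation ρ ∈ G^* and any R > 5. Let T := ⌊(1/2)·n·log n − R·n⌋ (with n large enough that T ≥ 0), and suppose σ ∈ S satisfies n^{{id}}_non(σ) ≤ n/3. Then the product replacement chain started at σ satisfies Pr_σ(‖x_ρ(σ_T)‖_HS ≤ R/√n) ≤ 4·Q²/R². -/

import Mathlib

open scoped BigOperators
open Filter

attribute [local instance] Classical.propDecidable

noncomputable section

namespace PR

variable (G : Type) [Group G] [Fintype G]

/-- A configuration: an `n`-tuple of elements of `G`. -/
abbrev Config (n : ℕ) := Fin n → G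

/-- The set of generating `n`-tuples. -/
def gens (n : ℕ) : Set (Config G n) :=
  {σ | Subgroup.closure (Set.range σ) = ⊤}

/-- A move of the product replacement chain: an ordered pair of distinct indices
together with a sign (`true` = multiply, `false` = multiply by inverse). -/
abbrev Move (n : ℕ) := {p : Fin n × Fin n // p.1 ≠ p.2} × Bool

/-- Applying a move: replace `σ i` by `σ i * (σ j)^{±1}`. -/
def applyMove {n : ℕ} (σ : Config G n) (m : Move n) : Config G n :=
  Function.update σ m.1.1.1
    (σ m.1.1.1 * (if m.2 then σ m.1.1.2 else (σ m.1.1.2)⁻¹))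

/-- One-step transition probability of the product replacement chain. -/
def step {n : ℕ} (σ σ' : Config G n) : ℝ :=
  ((Finset.univ.filter (fun m : Move n => applyMove G σ m = σ')).card : ℝ) /
    (Fintype.card (Move n) : ℝ)

/-- The law of `σ_t` for the chain started at `σ₀`. -/
def law {n : ℕ} (σ₀ : Config G n) : ℕ → Config G n → ℝ
  | 0 => fun σ' => if σ' = σ₀ then 1 else 0
  | (t + 1) => fun σ' => ∑ τ : Config G n, law σ₀ t τ * step G τ σ'

/-- Probability that `σ_t ∈ E` for the chain started at `σ₀`. -/
def prob {n : ℕ} (σ₀ : Config G n) (t : ℕ) (E : Set (Config G n)) : ℝ :=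
  ∑ τ ∈ Finset.univ.filter (fun τ => τ ∈ E), law G σ₀ t τ

/-- Probability of a trajectory event for the chain started at `σ₀`, over the
time horizon `{0, 1, …, T}`. -/
def pathProb {n : ℕ} (σ₀ : Config G n) (T : ℕ)
    (E : Set (Fin (T + 1) → Config G n)) : ℝ :=
  ∑ p ∈ Finset.univ.filter
      (fun p : Fin (T + 1) → Config G n => p 0 = σ₀ ∧ p ∈ E),
    ∏ t : Fin T, step G (p t.castSucc) (p t.succ)

/-- `n_a(σ)`: the number of sites holding the group element `a`. -/
def nCount {n : ℕ} (σ : Config G n) (a : G) : ℕ :=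
  (Finset.univ.filter (fun i => σ i = a)).card

/-- `n^H_non(σ)`: the number of sites whose element lies outside `H`. -/
def nNon {n : ℕ} (H : Subgroup G) (σ : Config G n) : ℕ :=
  (Finset.univ.filter (fun i => σ i ∉ H)).card

/-- `n^{id}_non(σ)`: the number of sites not holding the identity. -/
def nNonId {n : ℕ} (σ : Config G n) : ℕ :=
  (Finset.univ.filter (fun i => σ i ≠ 1)).card

/-- `S_non(c)`. -/
def SNon (n : ℕ) (c : ℝ) : Set (Config G n) :=
  {σ | σ ∈ gens G n ∧
    ∀ H : Subgroup G, H ≠ ⊤ → c * n ≤ (nNon G H σ : ℝ)}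

/-- The `δ`-typical set `S_*(δ)`. -/
def SAst (n : ℕ) (δ : ℝ) : Set (Config G n) :=
  {σ | σ ∈ gens G n ∧
    Real.sqrt (∑ a : G, ((nCount G σ a : ℝ) / n - 1 / (Fintype.card G : ℝ)) ^ 2) ≤ δ}

/-- `n^{σ₀}_{a,b}(σ)`. -/
def nab {n : ℕ} (σ₀ σ : Config G n) (a b : G) : ℕ :=
  (Finset.univ.filter (fun i => σ₀ i = a ∧ σ i = b)).card

/-- `S_*(σ₀, r)`. -/
def SAstM {n : ℕ} (σ₀ : Config G n) (r : ℝ) : Set (Config G n) :=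
  {σ | σ ∈ gens G n ∧
    ∀ a : G, Real.sqrt (∑ b : G,
      ((nab G σ₀ σ a b : ℝ) / (nCount G σ₀ a : ℝ) - 1 / (Fintype.card G : ℝ)) ^ 2) ≤ r}

/-- The uniform stationary distribution `π` on the set of generating tuples. -/
def statDist (n : ℕ) : Config G n → ℝ := fun σ =>
  if σ ∈ gens G n then
    1 / ((Finset.univ.filter (fun τ : Config G n => τ ∈ gens G n)).card : ℝ)
  else 0

/-- Total-variation distance between two (finitely supported) signed weights,
as the supremum over finite sets `A` of `|p(A) - q(A)|`. -/
def tvDist {α : Type*} (p q : α → ℝ) : ℝ :=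
  sSup {x : ℝ | ∃ A : Finset α, x = |∑ a ∈ A, p a - ∑ a ∈ A, q a|}

/-- `d_σ(t) = max_{A ⊆ S} |P_σ(σ_t ∈ A) - π(A)|`. -/
def dTV {n : ℕ} (σ : Config G n) (t : ℕ) : ℝ :=
  sSup {x : ℝ | ∃ A : Finset (Config G n), ↑A ⊆ gens G n ∧
    x = |∑ τ ∈ A, law G σ t τ - ∑ τ ∈ A, statDist G n τ|}

/-- `max_{σ ∈ S} d_σ(t)`. -/
def dMax (n : ℕ) (t : ℕ) : ℝ :=
  sSup {x : ℝ | ∃ σ ∈ gens G n, x = dTV G σ t}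

end PR

namespace PR

variable (G : Type) [Group G] [Fintype G]

/-- A unitary representation of `G` of dimension `d`, as a monoid homomorphism into the
unitary group of `d × d` complex matrices. -/
abbrev UnitaryRep (d : ℕ) := G →* Matrix.unitaryGroup (Fin d) ℂ

/-- A representation is non-trivial if some group element acts non-trivially. -/
def IsNontrivialRep {d : ℕ} (ρ : UnitaryRep G d) : Prop :=
  ∃ a : G, ((ρ a : Matrix (Fin d) (Fin d) ℂ)) ≠ 1

/-- Irreducibility: the only invariant subspaces are `⊥` and `⊤`. -/
def IsIrreducibleRep {d : ℕ} (ρ : UnitaryRep G d) : Prop :=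
  ∀ W : Submodule ℂ (Fin d → ℂ),
    (∀ a : G, ∀ w ∈ W, ((ρ a : Matrix (Fin d) (Fin d) ℂ)).mulVec w ∈ W) →
    W = ⊥ ∨ W = ⊤

/-- Hilbert–Schmidt norm of a complex matrix. -/
def hsNorm {d : ℕ} (A : Matrix (Fin d) (Fin d) ℂ) : ℝ :=
  Real.sqrt (∑ i : Fin d, ∑ j : Fin d, ‖A i j‖ ^ 2)

/-- Operator norm (`ℓ² → ℓ²`) of a complex matrix. -/
def opNorm {d : ℕ} (A : Matrix (Fin d) (Fin d) ℂ) : ℝ :=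
  ‖LinearMap.toContinuousLinearMap (Matrix.toEuclideanLin A)‖

/-- The Fourier coefficient `x_ρ(σ) = Σ_a (n_a(σ)/n) ρ(a)`. -/
def xCoeff {n d : ℕ} (ρ : UnitaryRep G d) (σ : Config G n) :
    Matrix (Fin d) (Fin d) ℂ :=
  ∑ a : G, (((nCount G σ a : ℝ) / (n : ℝ) : ℝ) : ℂ) • (ρ a : Matrix (Fin d) (Fin d) ℂ)

/-- `X_ρ(σ) = (1/(n−1)) ((x_ρ(σ) + x_ρ(σ)^*)/2 − ((n−1)/n) I)`. -/
def XMat {n d : ℕ} (ρ : UnitaryRep G d) (σ : Config G n) :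
    Matrix (Fin d) (Fin d) ℂ :=
  (((n : ℂ) - 1)⁻¹) •
    ((xCoeff G ρ σ + star (xCoeff G ρ σ)) / 2 - (((n : ℂ) - 1) / (n : ℂ)) • (1 : Matrix (Fin d) (Fin d) ℂ))

/-- The Fourier coefficient `y^{σ_*}_{a,ρ}(σ) = Σ_b (n^{σ_*}_{a,b}(σ)/n_a(σ_*)) ρ(b)`. -/
def yCoeff {n d : ℕ} (ρ : UnitaryRep G d) (σast σ : Config G n) (a : G) :
    Matrix (Fin d) (Fin d) ℂ :=
  ∑ b : G, (((nab G σast σ a b : ℝ) / (nCount G σast a : ℝ) : ℝ) : ℂ) •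
    (ρ b : Matrix (Fin d) (Fin d) ℂ)

end PR

namespace PR

section Chain

variable {G : Type} [Group G] {n : ℕ}

/-- A sum over all moves, as a sum over all pairs of indices minus the diagonal. -/
lemma sum_move (f : Fin n → Fin n → Bool → ℝ) :
    ∑ m : Move n, f m.1.1.1 m.1.1.2 m.2 =
      ∑ i, ∑ j, (f i j true + f i j false) - ∑ i, (f i i true + f i i false) := by
  have hsub : ∀ h : Fin n × Fin n → ℝ,
      ∑ p : {p : Fin n × Fin n // p.1 ≠ p.2}, h p.1 = ∑ i, ∑ j, h (i, j) - ∑ i, h (i, i) := by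
    intro h
    have h1 : ∑ p : {p : Fin n × Fin n // p.1 ≠ p.2}, h p.1 =
        ∑ p ∈ Finset.univ.filter (fun p : Fin n × Fin n => p.1 ≠ p.2), h p :=
      (Finset.sum_subtype _ (by simp) h).symm
    rw [h1, Finset.sum_filter, Fintype.sum_prod_type, ← Finset.sum_sub_distrib]
    refine Finset.sum_congr rfl fun i _ => ?_
    have h2 : ∑ j, (if i = j then h (i, j) else 0) = h (i, i) := by simp
    rw [← h2, ← Finset.sum_sub_distrib]
    refine Finset.sum_congr rfl fun j _ => ?_
    by_cases hij : i = j <;> simp [hij]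
  rw [Fintype.sum_prod_type]
  simp only [Fintype.sum_bool]
  exact hsub fun p => f p.1 p.2 true + f p.1 p.2 false

lemma card_move : (Fintype.card (Move n) : ℝ) = 2 * n * (n - 1) := by
  have h := sum_move (n := n) fun _ _ _ => 1
  simp only [Finset.sum_const, Finset.card_univ, Fintype.card_fin, nsmul_eq_mul] at h
  rw [mul_one] at h
  rw [h]
  ring

/-- The empirical average of `χ` over the sites of a configuration. -/
def siteAverage (χ : G → ℝ) (τ : Config G n) : ℝ := (∑ i, χ (τ i)) / n

lemma siteAverage_applyMove_sub (χ : G → ℝ) (τ : Config G n) (m : Move n) :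
    siteAverage χ (applyMove G τ m) - siteAverage χ τ =
      (χ (τ m.1.1.1 * (if m.2 then τ m.1.1.2 else (τ m.1.1.2)⁻¹)) - χ (τ m.1.1.1)) / n := by
  unfold siteAverage applyMove
  rw [← sub_div, ← Finset.sum_sub_distrib]
  congr 1
  rw [Finset.sum_eq_single m.1.1.1]
  · simp
  · intro i _ hi
    simp [Function.update_of_ne hi]
  · simp

/-- Lower bound on the mean one-step increment of the average of a function `χ` of positive type. -/
lemma le_sum_siteAverage_sub (hn : 2 ≤ n) {χ : G → ℝ} (hχ : ∀ a, |χ a| ≤ 1)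
    (hpos : ∀ τ : Config G n, 0 ≤ ∑ i, ∑ j, (χ (τ i * τ j) + χ (τ i * (τ j)⁻¹)))
    (τ : Config G n) :
    Fintype.card (Move n) * (-(1 / (n * (n - 1))) - siteAverage χ τ / n) ≤
      ∑ m : Move n, (siteAverage χ (applyMove G τ m) - siteAverage χ τ) := by
  have hn' : (2 : ℝ) ≤ n := by exact_mod_cast hn
  have h1 : (n : ℝ) - 1 ≠ 0 := by linarith
  have h0 : (n : ℝ) ≠ 0 := by linarith
  simp only [siteAverage_applyMove_sub]
  rw [sum_move fun i j b => (χ (τ i * (if b then τ j else (τ j)⁻¹)) - χ (τ i)) / n, card_move]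
  have hS : ∑ i, χ (τ i) = n * siteAverage χ τ := by
    unfold siteAverage
    field_simp
  have hfull : ∑ i, ∑ j, ((χ (τ i * (if true then τ j else (τ j)⁻¹)) - χ (τ i)) / n +
      (χ (τ i * (if false then τ j else (τ j)⁻¹)) - χ (τ i)) / n) =
      (∑ i, ∑ j, (χ (τ i * τ j) + χ (τ i * (τ j)⁻¹))) / n - 2 * (n * siteAverage χ τ) := by
    rw [← hS, Finset.sum_div, Finset.mul_sum, ← Finset.sum_sub_distrib]
    refine Finset.sum_congr rfl fun i _ => ?_
    have : 2 * χ (τ i) = ∑ _j : Fin n, 2 * χ (τ i) / n := by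
      simp only [Finset.sum_const, Finset.card_univ, Fintype.card_fin, nsmul_eq_mul]
      field_simp
    rw [this, Finset.sum_div, ← Finset.sum_sub_distrib]
    refine Finset.sum_congr rfl fun j _ => ?_
    simp only [if_true, Bool.false_eq_true, if_false]
    ring
  have hdiag : ∑ i, ((χ (τ i * (if true then τ i else (τ i)⁻¹)) - χ (τ i)) / n +
      (χ (τ i * (if false then τ i else (τ i)⁻¹)) - χ (τ i)) / n) ≤
      2 - 2 * siteAverage χ τ := by
    have : 2 - 2 * siteAverage χ τ = ∑ i, (2 / n - 2 * (χ (τ i) / n)) := by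
      rw [Finset.sum_sub_distrib, ← Finset.mul_sum, Finset.sum_const, Finset.card_univ, Fintype.card_fin,
        nsmul_eq_mul, mul_div_cancel₀ _ h0, ← Finset.sum_div, siteAverage]
    rw [this]
    refine Finset.sum_le_sum fun i _ => ?_
    simp only [if_true, Bool.false_eq_true, if_false]
    have h2 := (abs_le.mp (hχ (τ i * τ i))).2
    have h3 := (abs_le.mp (hχ (τ i * (τ i)⁻¹))).2
    rw [← add_div, ← mul_div_assoc, ← sub_div]
    exact div_le_div_of_nonneg_right (by linarith) (by linarith)
  have hp := div_nonneg (hpos τ) (show (0 : ℝ) ≤ n by linarith)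
  have hL : 2 * (n : ℝ) * (n - 1) * (-(1 / (n * (n - 1))) - siteAverage χ τ / n) =
      -2 - 2 * (n - 1) * siteAverage χ τ := by
    field_simp
  rw [hfull, hL]
  linarith

/-- If `w ≤ p + (mean of D) - D` the positive part of `w` has mean square at most
`p ^ 2` plus the mean square of `D`. -/
lemma sum_sq_posPart_le {M : Type*} [Fintype M] (hM : (Fintype.card M : ℝ) ≠ 0) {D w : M → ℝ}
    {p K : ℝ} (hD : ∀ m, (D m) ^ 2 ≤ K)
    (hw : ∀ m, w m ≤ p + (∑ m, D m) / Fintype.card M - D m) :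
    (∑ m, (max 0 (w m)) ^ 2) / Fintype.card M ≤ p ^ 2 + K := by
  have hM' : (0 : ℝ) < Fintype.card M := lt_of_le_of_ne (Nat.cast_nonneg _) (Ne.symm hM)
  set N : ℝ := (Fintype.card M : ℝ) with hN
  set s := (∑ m, D m) / N with hs
  have hsum : ∑ m, D m = N * s := by rw [hs]; field_simp
  rw [div_le_iff₀ hM']
  calc ∑ m, (max 0 (w m)) ^ 2 ≤ ∑ m, ((p ^ 2 + K + 2 * p * s + s ^ 2) - 2 * (p + s) * D m) := by
        refine Finset.sum_le_sum fun m _ => ?_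
        have h1 := hw m
        have h2 := hD m
        have h3 : (max 0 (w m)) ^ 2 ≤ (p + s - D m) ^ 2 := by
          rcases le_total (w m) 0 with h | h
          · rw [max_eq_left h]; nlinarith [sq_nonneg (p + s - D m)]
          · rw [max_eq_right h]; exact pow_le_pow_left₀ h h1 2
        nlinarith
    _ = N * (p ^ 2 + K + 2 * p * s + s ^ 2) - 2 * (p + s) * (N * s) := by
        rw [Finset.sum_sub_distrib, ← Finset.mul_sum, hsum]
        rw [Finset.sum_const, Finset.card_univ, nsmul_eq_mul]
    _ ≤ (p ^ 2 + K) * N := by nlinarith [mul_nonneg hM'.le (sq_nonneg s)]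

variable [Fintype G]

lemma sum_step_mul (τ : Config G n) (f : Config G n → ℝ) :
    ∑ σ', step G τ σ' * f σ' =
      (∑ m : Move n, f (applyMove G τ m)) / Fintype.card (Move n) := by
  simp only [step, div_mul_eq_mul_div]
  rw [← Finset.sum_div]
  congr 1
  rw [← Finset.sum_fiberwise (s := Finset.univ) (g := fun m : Move n => applyMove G τ m)]
  refine Finset.sum_congr rfl fun σ' _ => ?_
  rw [Finset.sum_congr rfl (g := fun _ => f σ')]
  · simp
  · intro m hm
    rw [(Finset.mem_filter.mp hm).2]

lemma law_nonneg (σ : Config G n) (t : ℕ) (τ : Config G n) : 0 ≤ law G σ t τ := by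
  induction t generalizing τ with
  | zero => simp only [law]; split_ifs <;> norm_num
  | succ t ih =>
    exact Finset.sum_nonneg fun τ' _ => mul_nonneg (ih τ') (by unfold step; positivity)

lemma sum_law_succ_mul (σ : Config G n) (t : ℕ) (f : Config G n → ℝ) :
    ∑ τ, law G σ (t + 1) τ * f τ = ∑ τ, law G σ t τ *
      ((∑ m : Move n, f (applyMove G τ m)) / Fintype.card (Move n)) := by
  simp only [law, Finset.sum_mul]
  rw [Finset.sum_comm]
  refine Finset.sum_congr rfl fun τ _ => ?_
  rw [← sum_step_mul, Finset.mul_sum]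
  exact Finset.sum_congr rfl fun _ _ => mul_assoc _ _ _

lemma sum_law (hn : 2 ≤ n) (σ : Config G n) (t : ℕ) : ∑ τ, law G σ t τ = 1 := by
  induction t with
  | zero => simp [law]
  | succ t ih =>
    have hn' : (2 : ℝ) ≤ n := by exact_mod_cast hn
    have hN : (Fintype.card (Move n) : ℝ) ≠ 0 := by
      rw [card_move]
      exact (mul_pos (by linarith) (by linarith)).ne'
    have h := sum_law_succ_mul σ t fun _ => 1
    simp only [Finset.sum_const, Finset.card_univ, nsmul_eq_mul, mul_one, div_self hN] at h
    rw [h, ih]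

/-- The deterministic lower envelope for the average of a function of positive type. -/
def envelope (n : ℕ) (x : ℝ) : ℕ → ℝ
  | 0 => x
  | t + 1 => (1 - 1 / n) * envelope n x t - 1 / (n * (n - 1))

lemma le_envelope (hn : 2 ≤ n) (x : ℝ) (t : ℕ) :
    (1 - 1 / (n : ℝ)) ^ t * x - 1 / (n - 1) ≤ envelope n x t := by
  have hn' : (2 : ℝ) ≤ n := by exact_mod_cast hn
  have h1 : (n : ℝ) - 1 ≠ 0 := by linarith
  have h0 : (n : ℝ) ≠ 0 := by linarith
  have hq : (0 : ℝ) ≤ 1 - 1 / n := by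
    rw [sub_nonneg, div_le_one (by linarith)]
    linarith
  induction t with
  | zero =>
    have : (0 : ℝ) ≤ 1 / (n - 1) := one_div_nonneg.mpr (by linarith)
    simp only [envelope]
    linarith
  | succ t ih =>
    have h := mul_le_mul_of_nonneg_left ih hq
    have e : (1 - 1 / (n : ℝ)) * (1 / (n - 1)) + 1 / (n * (n - 1)) = 1 / (n - 1) := by
      field_simp
      ring
    simp only [envelope]
    rw [pow_succ]
    linarith

/-- The lower deviations from the envelope have second moment at most `4 / n`. -/
lemma sum_law_mul_sq_deficit_le (hn : 2 ≤ n) {χ : G → ℝ} (hχ : ∀ a, |χ a| ≤ 1)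
    (hpos : ∀ τ : Config G n, 0 ≤ ∑ i, ∑ j, (χ (τ i * τ j) + χ (τ i * (τ j)⁻¹)))
    (σ : Config G n) (t : ℕ) :
    ∑ τ, law G σ t τ * (max 0 (envelope n (siteAverage χ σ) t - siteAverage χ τ)) ^ 2
      ≤ 4 / n := by
  have hn' : (2 : ℝ) ≤ n := by exact_mod_cast hn
  have h0 : (0 : ℝ) < n := by linarith
  have hN : (0 : ℝ) < Fintype.card (Move n) := by
    rw [card_move]
    exact mul_pos (by linarith) (by linarith)
  have hq : (0 : ℝ) ≤ 1 - 1 / n := by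
    rw [sub_nonneg, div_le_one h0]
    linarith
  induction t with
  | zero =>
    simp only [law, envelope, ite_mul, one_mul, zero_mul, Finset.sum_ite_eq', Finset.mem_univ,
      if_true, sub_self, max_self]
    rw [zero_pow two_ne_zero]
    positivity
  | succ t ih =>
    rw [sum_law_succ_mul]
    set e := envelope n (siteAverage χ σ) t with he
    have hstep : ∀ τ : Config G n,
        (∑ m : Move n, (max 0 (envelope n (siteAverage χ σ) (t + 1) -
          siteAverage χ (applyMove G τ m))) ^ 2) / Fintype.card (Move n) ≤
        ((1 - 1 / n) * max 0 (e - siteAverage χ τ)) ^ 2 + (2 / n) ^ 2 := by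
      intro τ
      refine sum_sq_posPart_le hN.ne'
        (D := fun m => siteAverage χ (applyMove G τ m) - siteAverage χ τ)
        (fun m => ?_) (fun m => ?_)
      · rw [siteAverage_applyMove_sub, div_pow, div_pow]
        refine div_le_div_of_nonneg_right (sq_le_sq' ?_ ?_) (by positivity)
        · linarith [(abs_le.mp (hχ (τ m.1.1.1 * (if m.2 then τ m.1.1.2 else (τ m.1.1.2)⁻¹)))).1,
            (abs_le.mp (hχ (τ m.1.1.1))).2]
        · linarith [(abs_le.mp (hχ (τ m.1.1.1 * (if m.2 then τ m.1.1.2 else (τ m.1.1.2)⁻¹)))).2,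
            (abs_le.mp (hχ (τ m.1.1.1))).1]
      · have hd := le_sum_siteAverage_sub hn hχ hpos τ
        rw [mul_comm, ← le_div_iff₀ hN] at hd
        have hm := mul_le_mul_of_nonneg_left (le_max_right 0 (e - siteAverage χ τ)) hq
        have hx : (1 - 1 / (n : ℝ)) * (e - siteAverage χ τ) =
            (1 - 1 / n) * e - siteAverage χ τ + siteAverage χ τ / n := by ring
        simp only [envelope, ← he]
        linarith
    calc _ ≤ ∑ τ, law G σ t τ *
          (((1 - 1 / n) * max 0 (e - siteAverage χ τ)) ^ 2 + (2 / n) ^ 2) :=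
          Finset.sum_le_sum fun τ _ => mul_le_mul_of_nonneg_left (hstep τ) (law_nonneg σ t τ)
      _ = (1 - 1 / n) ^ 2 * ∑ τ, law G σ t τ * (max 0 (e - siteAverage χ τ)) ^ 2 +
          (2 / n) ^ 2 := by
          simp only [mul_add, Finset.sum_add_distrib]
          rw [← Finset.sum_mul, sum_law hn σ t, one_mul, Finset.mul_sum]
          congr 1
          exact Finset.sum_congr rfl fun τ _ => by ring
      _ ≤ (1 - 1 / n) ^ 2 * (4 / n) + (2 / n) ^ 2 := by gcongr
      _ ≤ 4 / n := by
          rw [← sub_nonneg]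
          have : 4 / (n : ℝ) - ((1 - 1 / n) ^ 2 * (4 / n) + (2 / n) ^ 2) =
            4 * (n - 1) / n ^ 3 := by
            field_simp
            ring
          rw [this]
          exact div_nonneg (by linarith) (by positivity)

lemma prob_le_of_envelope (hn : 2 ≤ n) {χ : G → ℝ} (hχ : ∀ a, |χ a| ≤ 1)
    (hpos : ∀ τ : Config G n, 0 ≤ ∑ i, ∑ j, (χ (τ i * τ j) + χ (τ i * (τ j)⁻¹)))
    (σ : Config G n) (t : ℕ) {c δ : ℝ} (hδ : 0 < δ)
    (hc : c + δ ≤ envelope n (siteAverage χ σ) t) {E : Set (Config G n)}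
    (hE : ∀ τ ∈ E, siteAverage χ τ ≤ c) :
    prob G σ t E ≤ 4 / n / δ ^ 2 := by
  rw [le_div_iff₀ (by positivity)]
  refine le_trans ?_ (sum_law_mul_sq_deficit_le hn hχ hpos σ t)
  unfold prob
  rw [Finset.sum_mul]
  refine le_trans (Finset.sum_le_sum fun τ hτ => ?_)
    (Finset.sum_le_univ_sum_of_nonneg fun τ => mul_nonneg (law_nonneg σ t τ) (sq_nonneg _))
  refine mul_le_mul_of_nonneg_left (pow_le_pow_left₀ hδ.le (le_max_of_le_right ?_) 2)
    (law_nonneg σ t τ)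
  have := hE τ (Finset.mem_filter.mp hτ).2
  linarith

end Chain

section Character

variable {G : Type} [Group G] {n d : ℕ}

/-- The real part of the normalized character of a unitary representation. -/
def reChar (ρ : UnitaryRep G d) (a : G) : ℝ := (ρ a : Matrix (Fin d) (Fin d) ℂ).trace.re / d

lemma abs_reChar_le (ρ : UnitaryRep G d) (a : G) : |reChar ρ a| ≤ 1 := by
  unfold reChar
  rw [abs_div, Nat.abs_cast]
  refine div_le_one_of_le₀ ?_ (Nat.cast_nonneg _)
  refine (Complex.abs_re_le_norm _).trans ((norm_sum_le _ _).trans ?_)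
  refine (Finset.sum_le_sum fun i _ => entry_norm_bound_of_unitary (ρ a).2 i i).trans ?_
  simp

lemma reChar_one (hd : d ≠ 0) (ρ : UnitaryRep G d) : reChar ρ 1 = 1 := by
  have : (d : ℝ) ≠ 0 := by exact_mod_cast hd
  simp [reChar, this]

lemma re_trace_mul_self_add_mul_conjTranspose_nonneg (A : Matrix (Fin d) (Fin d) ℂ) :
    0 ≤ (A * A).trace.re + (A * A.conjTranspose).trace.re := by
  have h1 : (A * A).trace.re + (A * A.conjTranspose).trace.re =
      ∑ i, ∑ j, ((A i j * A j i).re + Complex.normSq (A i j)) := by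
    simp only [Matrix.trace, Matrix.diag, Matrix.mul_apply, Matrix.conjTranspose_apply,
      Complex.re_sum, ← Finset.sum_add_distrib]
    refine Finset.sum_congr rfl fun i _ => Finset.sum_congr rfl fun j _ => ?_
    simp [Complex.normSq_apply]
  have h2 : ∑ i, ∑ j, ((A i j * A j i).re + Complex.normSq (A i j)) =
      ∑ i, ∑ j, ((A i j * A j i).re + Complex.normSq (A j i)) := by
    conv_rhs => rw [Finset.sum_comm]
    refine Finset.sum_congr rfl fun i _ => Finset.sum_congr rfl fun j _ => ?_
    rw [mul_comm]
  have h3 : 0 ≤ ∑ i, ∑ j, (((A i j * A j i).re + Complex.normSq (A i j)) +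
      ((A i j * A j i).re + Complex.normSq (A j i))) := by
    refine Finset.sum_nonneg fun i _ => Finset.sum_nonneg fun j _ => ?_
    simp only [Complex.normSq_apply, Complex.mul_re]
    nlinarith [sq_nonneg ((A i j).re + (A j i).re), sq_nonneg ((A i j).im - (A j i).im)]
  simp only [Finset.sum_add_distrib] at h1 h2 h3
  linarith

lemma reChar_sum_nonneg (ρ : UnitaryRep G d) (τ : Config G n) :
    0 ≤ ∑ i, ∑ j, (reChar ρ (τ i * τ j) + reChar ρ (τ i * (τ j)⁻¹)) := by
  have h := re_trace_mul_self_add_mul_conjTranspose_nonneg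
    (∑ i, (ρ (τ i) : Matrix (Fin d) (Fin d) ℂ))
  have hinv : ∀ a, ((ρ a⁻¹ : Matrix (Fin d) (Fin d) ℂ)) =
      (ρ a : Matrix (Fin d) (Fin d) ℂ).conjTranspose := by
    intro a
    rw [map_inv]
    rfl
  have e : ∑ i, ∑ j, (reChar ρ (τ i * τ j) + reChar ρ (τ i * (τ j)⁻¹)) =
      (((∑ i, (ρ (τ i) : Matrix (Fin d) (Fin d) ℂ)) *
        (∑ i, (ρ (τ i) : Matrix (Fin d) (Fin d) ℂ))).trace.re +
      ((∑ i, (ρ (τ i) : Matrix (Fin d) (Fin d) ℂ)) *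
        (∑ i, (ρ (τ i) : Matrix (Fin d) (Fin d) ℂ)).conjTranspose).trace.re) / d := by
    rw [Matrix.conjTranspose_sum, Finset.sum_mul_sum, Finset.sum_mul_sum]
    simp only [Matrix.trace_sum, Complex.re_sum, ← Finset.sum_add_distrib, Finset.sum_div,
      reChar, map_mul, Submonoid.coe_mul, hinv, add_div]
  rw [e]
  exact div_nonneg h (Nat.cast_nonneg _)

lemma siteAverage_ge_of_nNonId_le {χ : G → ℝ} (hn : 0 < n) (hχ : ∀ a, |χ a| ≤ 1) (h1 : χ 1 = 1)
    {σ : Config G n} (hnon : (nNonId G σ : ℝ) ≤ (n : ℝ) / 3) : 1 / 3 ≤ siteAverage χ σ := by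
  have hn' : (0 : ℝ) < n := by exact_mod_cast hn
  unfold siteAverage
  rw [le_div_iff₀ hn']
  have h : ∑ i : Fin n, (1 - 2 * (if σ i ≠ 1 then (1 : ℝ) else 0)) ≤ ∑ i, χ (σ i) := by
    refine Finset.sum_le_sum fun i _ => ?_
    by_cases hi : σ i = 1
    · simp [hi, h1]
    · simp only [ne_eq, hi, not_false_eq_true, if_true]
      linarith [(abs_le.mp (hχ (σ i))).1]
  rw [Finset.sum_sub_distrib, ← Finset.mul_sum, Finset.sum_boole] at h
  unfold nNonId at hnon
  simp only [Finset.sum_const, Finset.card_univ, Fintype.card_fin, nsmul_eq_mul, mul_one] at h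
  linarith

variable [Fintype G]

lemma xCoeff_eq (ρ : UnitaryRep G d) (τ : Config G n) :
    xCoeff G ρ τ = ((n : ℂ)⁻¹) • ∑ i, (ρ (τ i) : Matrix (Fin d) (Fin d) ℂ) := by
  unfold xCoeff nCount
  rw [← Finset.sum_fiberwise (s := Finset.univ) (g := τ), Finset.smul_sum]
  refine Finset.sum_congr rfl fun a _ => ?_
  rw [Finset.sum_congr rfl (g := fun _ => (ρ a : Matrix (Fin d) (Fin d) ℂ))]
  · rw [Finset.sum_const, ← Nat.cast_smul_eq_nsmul ℂ, smul_smul]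
    congr 1
    push_cast
    rw [div_eq_mul_inv, mul_comm]
  · intro i hi
    rw [(Finset.mem_filter.mp hi).2]

lemma siteAverage_reChar (ρ : UnitaryRep G d) (τ : Config G n) :
    siteAverage (reChar ρ) τ = (xCoeff G ρ τ).trace.re / d := by
  rw [xCoeff_eq, Matrix.trace_smul, Matrix.trace_sum, smul_eq_mul,
    show ((n : ℂ)⁻¹) = (((n : ℝ)⁻¹ : ℝ) : ℂ) by push_cast; rfl, Complex.re_ofReal_mul,
    Complex.re_sum]
  unfold siteAverage reChar
  rw [← Finset.sum_div]
  ring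

lemma re_trace_div_le_hsNorm (A : Matrix (Fin d) (Fin d) ℂ) : A.trace.re / d ≤ hsNorm A := by
  unfold hsNorm
  have hentry : ∀ i, (A i i).re ≤ Real.sqrt (∑ i : Fin d, ∑ j : Fin d, ‖A i j‖ ^ 2) := by
    intro i
    refine (Complex.re_le_norm _).trans (Real.le_sqrt_of_sq_le ?_)
    refine le_trans ?_ (Finset.single_le_sum (f := fun i => ∑ j : Fin d, ‖A i j‖ ^ 2)
      (fun i _ => Finset.sum_nonneg fun j _ => sq_nonneg _) (Finset.mem_univ i))
    exact Finset.single_le_sum (f := fun j => ‖A i j‖ ^ 2)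
      (fun j _ => sq_nonneg _) (Finset.mem_univ i)
  refine div_le_of_le_mul₀ (Nat.cast_nonneg _) (Real.sqrt_nonneg _) ?_
  simp only [Matrix.trace, Matrix.diag, Complex.re_sum]
  refine (Finset.sum_le_sum fun i _ => hentry i).trans ?_
  simp [mul_comm]

end Character

/-- After `t ≤ n (log n / 2 - R)` steps, geometric decay at rate `1 - 1 / n` leaves at least
`exp (R - 1 / 2) / √n`. -/
lemma exp_div_sqrt_le_pow {n t : ℕ} {R : ℝ} (hn : 2 ≤ n) (hR : 0 ≤ R)
    (ht : (t : ℝ) ≤ (1 / 2 : ℝ) * n * Real.log n - R * n) :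
    Real.exp (R - 1 / 2) / Real.sqrt n ≤ (1 - 1 / (n : ℝ)) ^ t := by
  have hn' : (2 : ℝ) ≤ n := by exact_mod_cast hn
  have h0 : (0 : ℝ) < n := by linarith
  have h1 : (0 : ℝ) < n - 1 := by linarith
  have hbase : Real.exp (-(1 / (n - 1))) ≤ 1 - 1 / (n : ℝ) := by
    rw [Real.exp_neg, inv_le_comm₀ (Real.exp_pos _)
      (by rw [sub_pos, div_lt_one h0]; linarith)]
    have h2 : (1 - 1 / (n : ℝ))⁻¹ = 1 / (n - 1) + 1 := by
      have : 1 - 1 / (n : ℝ) = (n - 1) / n := by field_simp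
      rw [this, inv_div]
      field_simp
      ring
    rw [h2]
    exact Real.add_one_le_exp _
  refine le_trans ?_ (pow_le_pow_left₀ (Real.exp_pos _).le hbase t)
  rw [← Real.exp_nat_mul, div_eq_mul_inv, Real.sqrt_eq_rpow, Real.rpow_def_of_pos h0,
    ← Real.exp_neg, ← Real.exp_add, Real.exp_le_exp]
  have hlog : Real.log n ≤ n - 1 := Real.log_le_sub_one_of_pos h0
  have h3 : (t : ℝ) / (n - 1) ≤ 1 / 2 * Real.log n + 1 / 2 - R := by
    rw [div_le_iff₀ h1]
    nlinarith
  have h4 : (t : ℝ) * -(1 / (n - 1)) = -(t / (n - 1)) := by ring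
  rw [h4]
  linarith

lemma two_mul_add_two_le_exp {R : ℝ} (hR : 5 < R) : 2 * R + 2 ≤ 1 / 3 * Real.exp (R - 1 / 2) := by
  have h1 : Real.exp (R - 1 / 2) = Real.exp 1 ^ 4 * Real.exp (R - 9 / 2) := by
    rw [← Real.exp_nat_mul, ← Real.exp_add]
    congr 1
    push_cast
    ring
  have h2 : (50 : ℝ) ≤ Real.exp 1 ^ 4 := by
    have := Real.exp_one_gt_d9
    calc (50 : ℝ) ≤ 2.7 ^ 4 := by norm_num
      _ ≤ _ := pow_le_pow_left₀ (by norm_num) (by linarith) 4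
  have h3 := Real.add_one_le_exp (R - 9 / 2)
  rw [h1]
  nlinarith

end PR

/-- Lemma 5.2: for any non-trivial irreducible unitary `ρ ∈ G^*` and
`R > 5`, with `T = ⌊(1/2) n log n − R n⌋ ≥ 0`, if `σ ∈ S` satisfies `n^{id}_non(σ) ≤ n/3`
then `Pr_σ(‖x_ρ(σ_T)‖_HS ≤ R/√n) ≤ 4Q²/R²`. -/
theorem fourier_lower_bound
    (G : Type) [Group G] [Fintype G] (n : ℕ)
    (d : ℕ) (ρ : PR.UnitaryRep G d)
    (hnt : PR.IsNontrivialRep G ρ) (hirr : PR.IsIrreducibleRep G ρ)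
    (R : ℝ) (hR : 5 < R)
    (hT : R * n ≤ (1 / 2 : ℝ) * n * Real.log n)
    (σ : PR.Config G n) (hσ : σ ∈ PR.gens G n)
    (hnon : (PR.nNonId G σ : ℝ) ≤ (n : ℝ) / 3) :
    PR.prob G σ ⌊(1 / 2 : ℝ) * n * Real.log n - R * n⌋₊
      {τ | PR.hsNorm (PR.xCoeff G ρ τ) ≤ R / Real.sqrt n}
    ≤ 4 * (Fintype.card G : ℝ) ^ 2 / R ^ 2 := by
  have hn2 : 2 ≤ n := by
    by_contra hlt
    obtain rfl | rfl : n = 0 ∨ n = 1 := by omega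
    · obtain ⟨a, ha⟩ := hnt
      have hbot : (⊥ : Subgroup G) = ⊤ := by
        have h : Subgroup.closure (Set.range σ) = ⊤ := hσ
        rwa [Set.range_eq_empty, Subgroup.closure_empty] at h
      have ha1 : a = 1 := Subgroup.mem_bot.mp (hbot ▸ Subgroup.mem_top a)
      exact ha (by simp [ha1])
    · norm_num at hT
      linarith
  have hd : d ≠ 0 := by
    rintro rfl
    obtain ⟨a, ha⟩ := hnt
    exact ha (Subsingleton.elim _ _)
  have hn' : (2 : ℝ) ≤ n := by exact_mod_cast hn2
  set s := Real.sqrt n with hs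
  have hs0 : 0 < s := Real.sqrt_pos.mpr (by linarith)
  have hs2 : s ^ 2 = n := Real.sq_sqrt (by linarith)
  have hχ := PR.abs_reChar_le ρ
  set T := ⌊(1 / 2 : ℝ) * n * Real.log n - R * n⌋₊ with hTdef
  have hTle : (T : ℝ) ≤ (1 / 2 : ℝ) * n * Real.log n - R * n :=
    Nat.floor_le (sub_nonneg.mpr hT)
  have henv := PR.le_envelope hn2 (PR.siteAverage (PR.reChar ρ) σ) T
  have hpow := PR.exp_div_sqrt_le_pow hn2 (by linarith) hTle
  have hinit := PR.siteAverage_ge_of_nNonId_le (by omega) hχ (PR.reChar_one hd ρ) hnon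
  have hexp := PR.two_mul_add_two_le_exp hR
  have hgap : R / s + R / s ≤ PR.envelope n (PR.siteAverage (PR.reChar ρ) σ) T := by
    have h1 : 1 / ((n : ℝ) - 1) ≤ 1 / s * 2 := by
      rw [div_mul_eq_mul_div, div_le_div_iff₀ (by linarith) hs0]
      nlinarith [sq_nonneg (s - 1)]
    have h2 : (2 * R + 2) / s ≤ 1 / 3 * (Real.exp (R - 1 / 2) / s) := by
      rw [← mul_div_assoc]
      exact div_le_div_of_nonneg_right hexp hs0.le
    have h3 := mul_le_mul hpow hinit (by norm_num)
      (le_trans (div_nonneg (Real.exp_pos _).le hs0.le) hpow)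
    have h4 : (2 * R + 2) / s = R / s + R / s + 1 / s * 2 := by ring
    linarith
  refine (PR.prob_le_of_envelope hn2 hχ (PR.reChar_sum_nonneg ρ) σ T
    (c := R / s) (δ := R / s) (by positivity) hgap fun τ hτ => ?_).trans ?_
  · rw [PR.siteAverage_reChar]
    exact (PR.re_trace_div_le_hsNorm _).trans hτ
  · have hcard : (1 : ℝ) ≤ Fintype.card G := by exact_mod_cast Fintype.card_pos
    have e : 4 / (n : ℝ) / (R / s) ^ 2 = 4 / R ^ 2 := by
      rw [← hs2]
      field_simp
    rw [e]
    exact div_le_div_of_nonneg_right (by nlinarith) (by positivity)
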